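/- arXiv:2406.16133 — 3 statements merged into one kernel-verified Lean document; each statement's English description precedes it below -/
import Mathlib

section
/- Soundness: every theorem of the system FOL□ is logically valid, i.e., if A ∈ FOL□ then for every universal structure 𝒜 ∈ 𝔘𝔆, every valuation v on 𝒜 and every world w of 𝒜, we have 𝒜, v, w ⊨ A. -/
namespace FOLBoxPaper

/-- Formulas of the language L(∀,□): atoms `P_j(x₁,…,xₙ)` (predicate index and
list of variables), identity `x = y`, negation, implication, universal
quantification, and the modal operator □. Variables are natural numbers. -/
inductive Formula : Type
  | atom : ℕ → List ℕ → Formula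
  | eq : ℕ → ℕ → Formula
  | neg : Formula → Formula
  | imp : Formula → Formula → Formula
  | all : ℕ → Formula → Formula
  | box : Formula → Formula

namespace Formula

/-- Conjunction, defined as usual. -/
def and (A B : Formula) : Formula := neg (imp A (neg B))

/-- Disjunction, defined as usual. -/
def or (A B : Formula) : Formula := imp (neg A) B

/-- Biconditional, defined as usual. -/
def iff (A B : Formula) : Formula := (imp A B).and (imp B A)

/-- ◇A := ¬□¬A. -/
def dia (A : Formula) : Formula := neg (box (neg A))

/-- ∃xA := ¬∀x¬A. -/
def ex (x : ℕ) (A : Formula) : Formula := neg (all x (neg A))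

/-- A formula is □-free when it contains no occurrence of □. -/
def BoxFree : Formula → Prop
  | atom _ _ => True
  | eq _ _ => True
  | neg A => BoxFree A
  | imp A B => BoxFree A ∧ BoxFree B
  | all _ A => BoxFree A
  | box _ => False

/-- `FreeIn x A`: the variable x has at least one ∀□-free occurrence in A,
i.e. an occurrence that is neither in the scope of a quantifier binding x
nor in the scope of □. -/
def FreeIn (x : ℕ) : Formula → Prop
  | atom _ args => x ∈ args
  | eq a b => x = a ∨ x = b
  | neg A => FreeIn x A
  | imp A B => FreeIn x A ∨ FreeIn x B
  | all z A => z ≠ x ∧ FreeIn x A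
  | box _ => False

/-- The ∀□-free substitution `A(y/x)`: replace every ∀□-free occurrence of x
in A by y (occurrences in the scope of □ or of a quantifier binding x are
left untouched). -/
def subst (A : Formula) (y x : ℕ) : Formula :=
  match A with
  | atom j args => atom j (args.map fun z => if z = x then y else z)
  | eq a b => eq (if a = x then y else a) (if b = x then y else b)
  | neg A => neg (subst A y x)
  | imp A B => imp (subst A y x) (subst B y x)
  | all z A => if z = x then all z A else all z (subst A y x)
  | box A => box A

/-- `Substitutable y x A`: the variable y is substitutable for the ∀□-free
occurrences of x in A, i.e. y is not captured by a quantifier when it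
replaces x. -/
def Substitutable (y x : ℕ) : Formula → Prop
  | atom _ _ => True
  | eq _ _ => True
  | neg A => Substitutable y x A
  | imp A B => Substitutable y x A ∧ Substitutable y x B
  | all z A => z = x ∨ ¬ FreeIn x A ∨ (z ≠ y ∧ Substitutable y x A)
  | box _ => True

end Formula

open Formula

/-- A first-order structure with variable domains:
a nonempty set of possible worlds, a nonempty domain of objects for each
world, and a world-relative interpretation of the predicate symbols. -/
structure Structure where
  W : Type
  wNonempty : Nonempty W
  D : W → Type
  dNonempty : ∀ w, Nonempty (D w)
  I : ℕ → (w : W) → List (D w) → Prop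

/-- A valuation assigns, to each variable and world, an object of the domain
of that world. -/
def Valuation (M : Structure) : Type := ℕ → (w : M.W) → M.D w

open Classical in
/-- The variant `v^a_x(w)` of a valuation v at world w: it maps x at w to a
and agrees with v everywhere else. -/
noncomputable def updateVal {M : Structure} (v : Valuation M) (x : ℕ)
    (w : M.W) (a : M.D w) : Valuation M :=
  fun y w' => if h : y = x ∧ w' = w then cast (congrArg M.D h.2.symm) a else v y w'

/-- Satisfaction `M, v, w ⊨ A`. The clause for □ quantifies over all
valuations and all worlds of the structure. -/
def Sat (M : Structure) : Valuation M → M.W → Formula → Prop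
  | v, w, .atom j args => M.I j w (args.map fun z => v z w)
  | v, w, .eq a b => v a w = v b w
  | v, w, .neg A => ¬ Sat M v w A
  | v, w, .imp A B => Sat M v w A → Sat M v w B
  | v, w, .all x A => ∀ a : M.D w, Sat M (updateVal v x w a) w A
  | _, _, .box A => ∀ (v' : Valuation M) (w' : M.W), Sat M v' w' A

/-- `M ⊨ A`: A is satisfied at every valuation and world of M. -/
def Models (M : Structure) (A : Formula) : Prop := ∀ v w, Sat M v w A

/-- Universal structures: M is universal when every □-free formula true
everywhere in M is true everywhere in every structure. -/
def Universal (M : Structure) : Prop :=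
  ∀ B, BoxFree B → Models M B → ∀ N : Structure, Models N B

/-- Logical validity: truth at every valuation and world of every universal
structure. -/
def Valid (A : Formula) : Prop :=
  ∀ M : Structure, Universal M → ∀ (v : Valuation M) (w : M.W), Sat M v w A

/-- FOL: the set of □-free classical first-order theses, i.e. □-free formulas
satisfied at every valuation and world of every structure. -/
def FOL : Set Formula := {A | BoxFree A ∧ ∀ M : Structure, Models M A}

/-- `PropTaut A`: A is an instantiation of a tautology of classical
propositional logic (it is true under every assignment of truth values to
formulas that respects ¬ and →). -/
def PropTaut (A : Formula) : Prop :=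
  ∀ f : Formula → Prop,
    (∀ B, f (neg B) ↔ ¬ f B) → (∀ B C, f (imp B C) ↔ (f B → f C)) → f A

/-- The system FOL□. -/
inductive FOLBox : Formula → Prop
  | taut {A} : PropTaut A → FOLBox A
  | axK {A B} : FOLBox ((box (A.imp B)).imp ((box A).imp (box B)))
  | axT {A} : FOLBox ((box A).imp A)
  | ax5 {A} : FOLBox ((neg (box A)).imp (box (neg (box A))))
  | axAll1 {A : Formula} {x y : ℕ} : Substitutable y x A →
      FOLBox ((all x A).imp (A.subst y x))
  | axAll2 {A B : Formula} {x : ℕ} : ¬ FreeIn x A →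
      FOLBox ((all x (A.imp B)).imp (A.imp (all x B)))
  | axId {x : ℕ} : FOLBox (Formula.eq x x)
  | axEq {A : Formula} {x y : ℕ} : BoxFree A → Substitutable y x A →
      FOLBox (((Formula.eq x y).and A).imp (A.subst y x))
  | axMix {A : Formula} {x : ℕ} : FOLBox ((box A).imp (all x A))
  | axBang {A} : BoxFree A → A ∉ FOL → FOLBox (neg (box A))
  | mp {A B} : FOLBox (A.imp B) → FOLBox A → FOLBox B
  | nec {A} : FOLBox A → FOLBox (box A)

/-- The conjunction of a (nonempty) finite list of formulas. -/
def conjList : List Formula → Formula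
  | [] => Formula.eq 0 0
  | [A] => A
  | A :: B :: rest => A.and (conjList (B :: rest))

/-- FOL□-consistency: no finite conjunction of members of Γ has its negation
in FOL□. -/
def Consistent (Γ : Set Formula) : Prop :=
  ∀ L : List Formula, L ≠ [] → (∀ B ∈ L, B ∈ Γ) → ¬ FOLBox (neg (conjList L))

/-- Maximal FOL□-consistency. -/
def MaxConsistent (Γ : Set Formula) : Prop :=
  Consistent Γ ∧ ∀ A, A ∈ Γ ∨ neg A ∈ Γ

/-- ∃-saturation: whenever ¬∀xA ∈ Γ there is a variable y with
¬A(y/x) ∈ Γ via a ∀□-free substitution. -/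
def Saturated (Γ : Set Formula) : Prop :=
  ∀ (x : ℕ) (A : Formula), neg (all x A) ∈ Γ →
    ∃ y : ℕ, Substitutable y x A ∧ neg (A.subst y x) ∈ Γ

/-- MC: the family of all ∃-saturated maximal FOL□-consistent sets. -/
def MC : Set (Set Formula) := {Γ | Saturated Γ ∧ MaxConsistent Γ}

/-- An elementary disjunction: a formula of the form
`A ∨ ◇B ∨ □C₁ ∨ … ∨ □Cₙ` with A, B, C₁, …, Cₙ □-free. -/
def ElemDisj (D : Formula) : Prop :=
  ∃ (A B : Formula) (Cs : List Formula),
    BoxFree A ∧ BoxFree B ∧ (∀ C ∈ Cs, BoxFree C) ∧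
    D = (Cs.map Formula.box).foldl Formula.or (A.or B.dia)

/-- A conjunctive form: a conjunction of elementary disjunctions. -/
def ConjForm (F : Formula) : Prop :=
  ∃ Ds : List Formula, Ds ≠ [] ∧ (∀ D ∈ Ds, ElemDisj D) ∧ F = conjList Ds

/-- The worlds of the canonical structure: members of MC. -/
def MCW : Type := {Γ : Set Formula // Γ ∈ MC}

/-- The relation ∼_Γ on variables: x ∼_Γ y iff the formula x = y belongs
to Γ. -/
def canonRel (Γ : MCW) (x y : ℕ) : Prop := Formula.eq x y ∈ Γ.val

/-- The canonical structure 𝒜^MC: worlds are the members of MC, the domain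
of a world Γ consists of the classes [x]_{∼_Γ} of variables, and a predicate
holds of such classes iff the corresponding atomic formula belongs to Γ. -/
noncomputable def canonicalStructure (h : Nonempty MCW) : Structure where
  W := MCW
  wNonempty := h
  D := fun Γ => Quot (canonRel Γ)
  dNonempty := fun Γ => ⟨Quot.mk _ 0⟩
  I := fun j Γ ds =>
    ∃ xs : List ℕ, ds = xs.map (Quot.mk (canonRel Γ)) ∧ Formula.atom j xs ∈ Γ.val

/-- The canonical valuation v^MC: v^MC(x, Γ) = [x]_{∼_Γ}. -/
noncomputable def canonicalVal (h : Nonempty MCW) : Valuation (canonicalStructure h) :=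
  fun x Γ => Quot.mk (canonRel Γ) x

theorem updateVal_same {M : Structure} (v : Valuation M) (x : ℕ) (w : M.W) (a : M.D w) :
    updateVal v x w a x w = a := by
  simp [updateVal]

theorem updateVal_of_ne {M : Structure} (v : Valuation M) {x y : ℕ} (w : M.W) (a : M.D w)
    (h : y ≠ x) : updateVal v x w a y w = v y w := by
  simp [updateVal, h]

/-- Satisfaction at a world depends only on the values there of the ∀□-free variables. -/
theorem sat_congr {M : Structure} {w : M.W} (A : Formula) {v v' : Valuation M}
    (h : ∀ x, FreeIn x A → v x w = v' x w) : Sat M v w A ↔ Sat M v' w A := by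
  induction A generalizing v v' with
  | atom j args =>
    simp only [Sat]
    rw [List.map_congr_left fun z hz => h z hz]
  | eq a b =>
    simp only [Sat]
    rw [h a (Or.inl rfl), h b (Or.inr rfl)]
  | neg A ih =>
    simp only [Sat]
    rw [ih h]
  | imp A B ihA ihB =>
    simp only [Sat]
    rw [ihA fun x hx => h x (Or.inl hx), ihB fun x hx => h x (Or.inr hx)]
  | all z A ih =>
    simp only [Sat]
    refine forall_congr' fun a => ih fun x hx => ?_
    by_cases hxz : x = z
    · subst hxz
      rw [updateVal_same, updateVal_same]
    · rw [updateVal_of_ne v w a hxz, updateVal_of_ne v' w a hxz]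
      exact h x ⟨Ne.symm hxz, hx⟩
  | box A => simp only [Sat]

theorem sat_updateVal_of_not_freeIn {M : Structure} {w : M.W} {A : Formula} {x : ℕ}
    (hx : ¬ FreeIn x A) (v : Valuation M) (a : M.D w) :
    Sat M (updateVal v x w a) w A ↔ Sat M v w A :=
  sat_congr A fun _ hy => updateVal_of_ne v w a fun h => hx (h ▸ hy)

theorem subst_of_not_freeIn {A : Formula} {x : ℕ} (y : ℕ) (hx : ¬ FreeIn x A) :
    A.subst y x = A := by
  induction A with
  | atom j args =>
    simp only [Formula.subst, Formula.atom.injEq, true_and]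
    refine (List.map_congr_left fun z hz => if_neg ?_).trans (List.map_id' args)
    rintro rfl
    exact hx hz
  | eq a b =>
    simp only [FreeIn, not_or] at hx
    simp only [Formula.subst, if_neg (Ne.symm hx.1), if_neg (Ne.symm hx.2)]
  | neg A ih => simp only [Formula.subst, ih hx]
  | imp A B ihA ihB =>
    simp only [FreeIn, not_or] at hx
    simp only [Formula.subst, ihA hx.1, ihB hx.2]
  | all z A ih =>
    by_cases hz : z = x
    · simp only [Formula.subst, if_pos hz]
    · simp only [Formula.subst, if_neg hz, ih fun h => hx ⟨hz, h⟩]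
  | box A => rfl

/-- The substitution lemma for ∀□-free substitutions. -/
theorem sat_subst {M : Structure} {w : M.W} {A : Formula} {x y : ℕ}
    (hA : Substitutable y x A) (v : Valuation M) :
    Sat M v w (A.subst y x) ↔ Sat M (updateVal v x w (v y w)) w A := by
  have hvar (v : Valuation M) (z : ℕ) :
      v (if z = x then y else z) w = updateVal v x w (v y w) z w := by
    split_ifs with hz
    · rw [hz, updateVal_same]
    · rw [updateVal_of_ne v w _ hz]
  induction A generalizing v with
  | atom j args => simp only [Formula.subst, Sat, List.map_map, Function.comp_def, hvar]
  | eq a b => simp only [Formula.subst, Sat, hvar]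
  | neg A ih => simp only [Formula.subst, Sat, ih hA]
  | imp A B ihA ihB => simp only [Formula.subst, Sat, ihA hA.1, ihB hA.2]
  | all z A ih =>
    by_cases hx : FreeIn x (all z A)
    · obtain ⟨hzy, hAs⟩ := (hA.resolve_left hx.1).resolve_left (not_not_intro hx.2)
      simp only [Formula.subst, if_neg hx.1, Sat]
      refine forall_congr' fun a => (ih hAs _).trans (sat_congr A fun u _ => ?_)
      rw [updateVal_of_ne v w a (Ne.symm hzy)]
      by_cases hux : u = x
      · subst hux
        rw [updateVal_same, updateVal_of_ne _ w a (Ne.symm hx.1), updateVal_same]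
      · rw [updateVal_of_ne _ w _ hux]
        by_cases huz : u = z
        · subst huz
          rw [updateVal_same, updateVal_same]
        · rw [updateVal_of_ne _ w _ huz, updateVal_of_ne _ w _ huz, updateVal_of_ne _ w _ hux]
    · rw [subst_of_not_freeIn y hx, sat_updateVal_of_not_freeIn hx]
  | box A => simp only [Formula.subst, Sat]

/-- Soundness: every theorem of FOL□ is logically valid. -/
theorem soundness (A : Formula) (hA : FOLBox A) : Valid A := by
  induction hA with
  | taut h => exact fun M _ v w => h (Sat M v w) (fun _ => Iff.rfl) fun _ _ => Iff.rfl
  | axK => exact fun _ _ _ _ hAB hA v w => hAB v w (hA v w)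
  | axT => exact fun _ _ v w hA => hA v w
  | ax5 => exact fun _ _ _ _ hA _ _ => hA
  | axAll1 hs => exact fun _ _ v w hA => (sat_subst hs v).2 (hA _)
  | axAll2 hx =>
    exact fun _ _ v w hAB hA a => hAB a ((sat_updateVal_of_not_freeIn hx v a).2 hA)
  | axId => exact fun _ _ _ _ => rfl
  | @axEq A x y _ hs =>
    intro M _ v w h
    obtain ⟨hxy, hA⟩ : v x w = v y w ∧ Sat M v w A := by
      simpa only [Formula.and, Sat, Classical.not_imp, not_not] using h
    refine (sat_subst hs v).2 ((sat_congr A fun u _ => ?_).1 hA)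
    by_cases hux : u = x
    · rw [hux, updateVal_same, hxy]
    · rw [updateVal_of_ne v w _ hux]
  | axMix => exact fun _ _ _ w hA _ => hA _ w
  | axBang hbf hA => exact fun _ hM _ _ hbox => hA ⟨hbf, hM _ hbf hbox⟩
  | mp _ _ ihAB ihA => exact fun M hM v w => ihAB M hM v w (ihA M hM v w)
  | nec _ ih => exact fun M hM _ _ v w => ih M hM v w

end FOLBoxPaper
end

section
/- For any two ∃-saturated maximal FOL□-consistent sets Γ, Δ ∈ MC and any □-free formula A: □A ∈ Γ if and only if □A ∈ Δ. -/
namespace FOLBoxPaper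

open Formula

namespace Formula

/-- A strict upper bound for the variables with an occurrence outside the scope of □. -/
def varBound : Formula → ℕ
  | atom _ args => args.sum + 1
  | eq a b => a + b + 1
  | neg A => varBound A
  | imp A B => varBound A + varBound B
  | all z A => z + 1 + varBound A
  | box _ => 0

/-- Simultaneous substitution `σ` of the ∀□-free occurrences of variables. -/
def msubst (σ : ℕ → ℕ) : Formula → Formula
  | atom j args => atom j (args.map σ)
  | eq a b => eq (σ a) (σ b)
  | neg A => neg (msubst σ A)
  | imp A B => imp (msubst σ A) (msubst σ B)
  | all z A => all z (msubst (Function.update σ z z) A)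
  | box A => box A

/-- The universal closure over all variables below `n`. -/
def closure : ℕ → Formula → Formula
  | 0, A => A
  | n + 1, A => all n (closure n A)

/-- An injective numbering of formulas. -/
def code : Formula → ℕ
  | atom j args => Nat.pair 0 (Nat.pair j (Encodable.encode args))
  | eq a b => Nat.pair 1 (Nat.pair a b)
  | neg A => Nat.pair 2 (code A)
  | imp A B => Nat.pair 3 (Nat.pair (code A) (code B))
  | all z A => Nat.pair 4 (Nat.pair z (code A))
  | box A => Nat.pair 5 (code A)

theorem code_injective : Function.Injective code := by
  intro A
  induction A with
  | atom j l => intro B h; cases B <;> simp_all [code, Nat.pair_eq_pair]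
  | eq a b => intro B h; cases B <;> simp_all [code, Nat.pair_eq_pair]
  | neg A ih =>
    intro B h
    cases B <;> simp_all [code, Nat.pair_eq_pair]
    exact ih rfl
  | imp A A' ih ih' =>
    intro B h
    cases B <;> simp_all [code, Nat.pair_eq_pair]
    exact ⟨ih rfl, ih' rfl⟩
  | all z A ih =>
    intro B h
    cases B <;> simp_all [code, Nat.pair_eq_pair]
    exact ih rfl
  | box A ih =>
    intro B h
    cases B <;> simp_all [code, Nat.pair_eq_pair]
    exact ih rfl

instance : Countable Formula := code_injective.countable

instance : Nonempty Formula := ⟨eq 0 0⟩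

theorem FreeIn.lt_varBound {x : ℕ} {A : Formula} (h : FreeIn x A) : x < varBound A := by
  induction A with
  | atom j l => exact Nat.lt_succ_of_le (List.le_sum_of_mem h)
  | eq a b => simp only [FreeIn, varBound] at *; omega
  | neg A ih => exact ih h
  | imp A B ihA ihB =>
    simp only [FreeIn, varBound] at *
    rcases h with h | h
    · have := ihA h; omega
    · have := ihB h; omega
  | all z A ih => have := ih h.2; simp only [varBound]; omega
  | box A => exact h.elim

theorem not_freeIn_of_varBound_le {x : ℕ} {A : Formula} (h : varBound A ≤ x) : ¬ FreeIn x A :=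
  fun hx => absurd hx.lt_varBound (by omega)

theorem subst_of_not_freeIn {x y : ℕ} {A : Formula} (h : ¬ FreeIn x A) : A.subst y x = A := by
  induction A with
  | atom j l =>
    simp only [FreeIn, subst] at *
    congr 1
    conv_rhs => rw [← List.map_id l]
    refine List.map_congr_left fun z hz => ?_
    rw [if_neg (by rintro rfl; exact h hz)]; rfl
  | eq a b =>
    simp only [FreeIn, not_or] at h
    simp [subst, Ne.symm h.1, Ne.symm h.2]
  | neg A ih => simp only [subst, ih h]
  | imp A B ihA ihB =>
    simp only [FreeIn, not_or] at h
    simp only [subst, ihA h.1, ihB h.2]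
  | all z A ih =>
    by_cases hz : z = x
    · simp [subst, hz]
    · simp only [subst, if_neg hz, ih fun hx => h ⟨hz, hx⟩]
  | box A => rfl

theorem subst_self (x : ℕ) (A : Formula) : A.subst x x = A := by
  induction A with
  | atom j l =>
    simp only [subst]
    congr 1
    conv_rhs => rw [← List.map_id l]
    refine List.map_congr_left fun z _ => ?_
    split_ifs with hz
    exacts [hz.symm, rfl]
  | eq a b => simp +contextual [subst]
  | neg A ih => simp [subst, ih]
  | imp A B ihA ihB => simp [subst, ihA, ihB]
  | all z A ih => simp [subst, ih]
  | box A => rfl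

theorem substitutable_self (x : ℕ) (A : Formula) : Substitutable x x A := by
  induction A with
  | atom j l => trivial
  | eq a b => trivial
  | neg A ih => exact ih
  | imp A B ihA ihB => exact ⟨ihA, ihB⟩
  | all z A ih =>
    by_cases hz : z = x
    · exact Or.inl hz
    · exact Or.inr (Or.inr ⟨hz, ih⟩)
  | box A => trivial

theorem subst_subst_cancel {x y : ℕ} {A : Formula} (h : varBound A ≤ y) :
    (A.subst y x).subst x y = A := by
  induction A with
  | atom j l =>
    have hl : ∀ z ∈ l, z ≠ y := by
      rintro z hz rfl
      exact not_freeIn_of_varBound_le h hz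
    simp only [subst, List.map_map]
    congr 1
    conv_rhs => rw [← List.map_id l]
    refine List.map_congr_left fun z hz => ?_
    by_cases hzx : z = x <;> simp [hzx, hl z hz]
  | eq a b =>
    simp only [varBound] at h
    simp only [subst]
    congr 1 <;> split_ifs <;> omega
  | neg A ih => simp only [subst, ih h]
  | imp A B ihA ihB =>
    simp only [varBound] at h
    simp only [subst, ihA (by omega), ihB (by omega)]
  | all z A ih =>
    simp only [varBound] at h
    have hzy : z ≠ y := by omega
    by_cases hz : z = x
    · simp only [subst, if_pos hz, if_neg hzy,
        subst_of_not_freeIn (not_freeIn_of_varBound_le (show varBound A ≤ y by omega))]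
    · simp only [subst, if_neg hz, if_neg hzy, ih (by omega)]
  | box A => rfl

theorem substitutable_subst_cancel {x y : ℕ} {A : Formula} (h : varBound A ≤ y) :
    Substitutable x y (A.subst y x) := by
  induction A with
  | atom j l => trivial
  | eq a b => trivial
  | neg A ih => exact ih h
  | imp A B ihA ihB =>
    simp only [varBound] at h
    exact ⟨ihA (by omega), ihB (by omega)⟩
  | all z A ih =>
    simp only [varBound] at h
    by_cases hz : z = x
    · simp only [subst, if_pos hz]
      exact Or.inr (Or.inl (not_freeIn_of_varBound_le (by omega)))
    · simp only [subst, if_neg hz]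
      exact Or.inr (Or.inr ⟨hz, ih (by omega)⟩)
  | box A => trivial

theorem not_freeIn_subst {x y : ℕ} (hxy : x ≠ y) (A : Formula) : ¬ FreeIn x (A.subst y x) := by
  induction A with
  | atom j l =>
    simp only [subst, FreeIn, List.mem_map, not_exists, not_and]
    intro z _
    split_ifs with hz
    · exact hxy.symm
    · exact hz
  | eq a b =>
    simp only [subst, FreeIn]
    split_ifs <;> omega
  | neg A ih => exact ih
  | imp A B ihA ihB => exact not_or.mpr ⟨ihA, ihB⟩
  | all z A ih =>
    by_cases hz : z = x
    · simp [subst, FreeIn, hz]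
    · simp [subst, FreeIn, hz, ih]
  | box A => exact id

theorem msubst_of_fixes_free {σ : ℕ → ℕ} {A : Formula} (h : ∀ v, FreeIn v A → σ v = v) :
    msubst σ A = A := by
  induction A generalizing σ with
  | atom j l =>
    simp only [msubst]
    congr 1
    conv_rhs => rw [← List.map_id l]
    exact List.map_congr_left h
  | eq a b => simp only [msubst, h a (Or.inl rfl), h b (Or.inr rfl)]
  | neg A ih => simp only [msubst, ih h]
  | imp A B ihA ihB =>
    simp only [msubst, ihA fun v hv => h v (Or.inl hv), ihB fun v hv => h v (Or.inr hv)]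
  | all z A ih =>
    simp only [msubst]
    congr 1
    refine ih fun v hv => ?_
    by_cases hvz : v = z
    · simp [hvz]
    · rw [Function.update_of_ne hvz]
      exact h v ⟨Ne.symm hvz, hv⟩
  | box A => rfl

theorem subst_msubst {σ : ℕ → ℕ} {x y : ℕ} (h : ∀ v, v ≠ x → σ v ≠ x) (A : Formula) :
    (msubst (Function.update σ x x) A).subst y x = msubst (Function.update σ x y) A := by
  induction A generalizing σ with
  | atom j l =>
    simp only [msubst, subst, List.map_map]
    congr 1
    refine List.map_congr_left fun z _ => ?_
    by_cases hz : z = x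
    · simp [hz]
    · simp [hz, h z hz]
  | eq a b =>
    have key : ∀ z, (if Function.update σ x x z = x then y else Function.update σ x x z) =
        Function.update σ x y z := by
      intro z
      by_cases hz : z = x
      · simp [hz]
      · simp [hz, h z hz]
    simp only [msubst, subst, key]
  | neg A ih => simp only [msubst, subst, ih h]
  | imp A B ihA ihB => simp only [msubst, subst, ihA h, ihB h]
  | all z A ih =>
    by_cases hz : z = x
    · subst hz
      simp [msubst, subst]
    · simp only [msubst, subst, if_neg hz]
      rw [Function.update_comm (Ne.symm hz), Function.update_comm (Ne.symm hz)]
      congr 1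
      refine ih fun v hv => ?_
      by_cases hvz : v = z
      · subst hvz; simpa using hz
      · rw [Function.update_of_ne hvz]; exact h v hv
  | box A => rfl

theorem substitutable_msubst {σ : ℕ → ℕ} {x y : ℕ} {A : Formula} (h : varBound A ≤ y) :
    Substitutable y x (msubst σ A) := by
  induction A generalizing σ with
  | atom j l => trivial
  | eq a b => trivial
  | neg A ih => exact ih h
  | imp A B ihA ihB =>
    simp only [varBound] at h
    exact ⟨ihA (by omega), ihB (by omega)⟩
  | all z A ih =>
    simp only [varBound] at h
    exact Or.inr (Or.inr ⟨by omega, ih (by omega)⟩)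
  | box A => trivial

theorem le_of_freeIn_closure {v n : ℕ} {A : Formula} (h : FreeIn v (closure n A)) :
    n ≤ v ∧ FreeIn v A := by
  induction n with
  | zero => exact ⟨Nat.zero_le _, h⟩
  | succ n ih =>
    have hinst := ih h.2
    have : n ≠ v := h.1
    exact ⟨by omega, hinst.2⟩

theorem BoxFree.closure {A : Formula} (h : BoxFree A) (n : ℕ) : BoxFree (closure n A) := by
  induction n with
  | zero => exact h
  | succ n ih => exact ih

end Formula

theorem Models.closure {M : Structure} {A : Formula} (h : Models M A) (n : ℕ) :
    Models M (closure n A) := by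
  induction n with
  | zero => exact h
  | succ n ih => exact fun v w a => ih _ w

namespace FOLBox

theorem imp_trans {A B C : Formula} (h₁ : FOLBox (A.imp B)) (h₂ : FOLBox (B.imp C)) :
    FOLBox (A.imp C) := by
  refine mp (mp (taut (A := (A.imp B).imp ((B.imp C).imp (A.imp C))) ?_) h₁) h₂
  intro f hn hi
  simp only [hi]
  tauto

theorem gen {A : Formula} (x : ℕ) (h : FOLBox A) : FOLBox (all x A) :=
  mp axMix (nec h)

theorem inst {A : Formula} {x y : ℕ} (h : FOLBox A) (hs : Substitutable y x A) :
    FOLBox (A.subst y x) :=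
  mp (axAll1 hs) (gen x h)

theorem closure_imp (n : ℕ) (A : Formula) : FOLBox ((closure n A).imp A) := by
  induction n with
  | zero => exact taut fun f _ hi => (hi _ _).mpr id
  | succ n ih =>
    have h := axAll1 (substitutable_self n (closure n A))
    rw [subst_self] at h
    exact imp_trans h ih

theorem eq_euclid (a b c : ℕ) :
    FOLBox (((Formula.eq a b).and (Formula.eq a c)).imp (Formula.eq b c)) := by
  obtain ⟨z, hb, hc⟩ : ∃ z, b ≠ z ∧ c ≠ z := ⟨b + c + 1, by omega, by omega⟩
  have h := axEq (A := Formula.eq z c) (x := z) (y := b) trivial trivial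
  have hinst := inst (x := z) (y := a) h (by simp [Formula.and, Substitutable, subst])
  simpa [Formula.and, subst, hb, hc] using hinst

theorem atom_congr (j a b : ℕ) (l m : List ℕ) :
    FOLBox (((Formula.eq a b).and (atom j (l ++ a :: m))).imp (atom j (l ++ b :: m))) := by
  obtain ⟨z, hb, hl, hm⟩ : ∃ z, b ≠ z ∧ z ∉ l ∧ z ∉ m := by
    refine ⟨b + l.sum + m.sum + 1, by omega, fun h => ?_, fun h => ?_⟩
    · have := List.le_sum_of_mem h; omega
    · have := List.le_sum_of_mem h; omega
  have key : ∀ (k : List ℕ) (y : ℕ), z ∉ k → (k.map fun v => if v = z then y else v) = k := by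
    intro k y hk
    conv_rhs => rw [← List.map_id k]
    refine List.map_congr_left fun v hv => ?_
    rw [if_neg (by rintro rfl; exact hk hv)]; rfl
  have h := axEq (A := atom j (l ++ z :: m)) (x := z) (y := b) trivial trivial
  have hinst := inst (x := z) (y := a) h (by simp [Formula.and, Substitutable, subst])
  simpa [Formula.and, subst, hb, key _ _ hl, key _ _ hm] using hinst

/-- A fresh witness for a negated universal formula preserves consistency. -/
theorem neg_of_fresh_witness {C B : Formula} {x y : ℕ} (hC : varBound C ≤ y)
    (hB : varBound (all x B) ≤ y) (hCB : FOLBox (C.imp (neg (all x B))))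
    (h : FOLBox (neg (C.and (neg (B.subst y x))))) : FOLBox (neg C) := by
  simp only [varBound] at hB
  have h₁ : FOLBox (C.imp (B.subst y x)) := by
    refine mp (taut ?_) h
    intro f hn hi
    simp only [Formula.and, hi, hn]
    tauto
  have h₂ : FOLBox (C.imp (all y (B.subst y x))) :=
    mp (axAll2 (not_freeIn_of_varBound_le hC)) (gen y h₁)
  have h₃ : FOLBox ((all y (B.subst y x)).imp B) := by
    have := axAll1 (substitutable_subst_cancel (x := x) (show varBound B ≤ y by omega))
    rwa [subst_subst_cancel (by omega)] at this
  have h₄ : FOLBox ((all y (B.subst y x)).imp (all x B)) :=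
    mp (axAll2 fun hf => not_freeIn_subst (show x ≠ y by omega) B hf.2) (gen x h₃)
  refine mp (mp (taut (A := (C.imp (all x B)).imp ((C.imp (neg (all x B))).imp (neg C))) ?_)
    (imp_trans h₂ h₄)) hCB
  intro f hn hi
  simp only [hi, hn]
  tauto

end FOLBox

/-- The Henkin witness, for the variable `y`, of a negated universal formula; any other formula
is its own witness. -/
def witness (y : ℕ) : Formula → Formula
  | neg (all x B) => neg (B.subst y x)
  | A => A

open Classical in
/-- One step of the Henkin construction: add `φ` and its witness to `C` if `φ` is consistent
with `C`. -/
noncomputable def henkinStep (N : ℕ) (C φ : Formula) : Formula :=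
  if FOLBox (neg (C.and φ)) then C
  else (C.and φ).and (witness (N + varBound (C.and φ)) φ)

theorem not_folBox_neg_and_witness {N : ℕ} {C φ : Formula} (h : ¬ FOLBox (neg (C.and φ))) :
    ¬ FOLBox (neg ((C.and φ).and (witness (N + varBound (C.and φ)) φ))) := by
  intro hw
  by_cases hφ : ∃ x B, φ = neg (all x B)
  · obtain ⟨x, B, rfl⟩ := hφ
    refine h (FOLBox.neg_of_fresh_witness (by omega) ?_ (FOLBox.taut ?_) hw)
    · simp only [Formula.and, varBound]; omega
    · intro f hn hi
      simp only [Formula.and, hi, hn]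
      tauto
  · have hwφ : witness (N + varBound (C.and φ)) φ = φ := by
      unfold witness
      split
      · exact absurd ⟨_, _, rfl⟩ hφ
      · rfl
    rw [hwφ] at hw
    refine h (FOLBox.mp (FOLBox.taut ?_) hw)
    intro f hn hi
    simp only [Formula.and, hi, hn]
    tauto

/-- The stages of the Henkin construction along an enumeration `e` of formulas. -/
noncomputable def henkinStage (N : ℕ) (e : ℕ → Formula) (C : Formula) : ℕ → Formula
  | 0 => C
  | n + 1 => henkinStep N (henkinStage N e C n) (e n)

theorem henkinStage_consistent {N : ℕ} {e : ℕ → Formula} {C : Formula}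
    (h : ¬ FOLBox (neg C)) (n : ℕ) : ¬ FOLBox (neg (henkinStage N e C n)) := by
  induction n with
  | zero => exact h
  | succ n ih =>
    simp only [henkinStage, henkinStep]
    split_ifs with hc
    · exact ih
    · exact not_folBox_neg_and_witness hc

theorem henkinStage_antitone {N : ℕ} {e : ℕ → Formula} {C : Formula} {m n : ℕ} (h : m ≤ n) :
    FOLBox ((henkinStage N e C n).imp (henkinStage N e C m)) := by
  induction n, h using Nat.le_induction with
  | base => exact FOLBox.taut fun f _ hi => (hi _ _).mpr id
  | succ n _ ih =>
    refine FOLBox.imp_trans ?_ ih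
    simp only [henkinStage, henkinStep]
    split_ifs
    · exact FOLBox.taut fun f _ hi => (hi _ _).mpr id
    · refine FOLBox.taut fun f hn hi => ?_
      simp only [Formula.and, hi, hn]
      tauto

/-- A deductively closed complete theory with witnesses among the variables `≥ N`. -/
structure IsHenkin (N : ℕ) (Δ : Set Formula) : Prop where
  thm : ∀ {A}, FOLBox A → A ∈ Δ
  mp : ∀ {A B}, A.imp B ∈ Δ → A ∈ Δ → B ∈ Δ
  neg_iff : ∀ A, neg A ∈ Δ ↔ A ∉ Δ
  exists_witness : ∀ {x B}, neg (all x B) ∈ Δ → ∃ k, neg (B.subst (N + k) x) ∈ Δ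

/-- Henkin's lemma: a consistent formula belongs to a Henkin theory. -/
theorem exists_isHenkin (N : ℕ) {C : Formula} (h : ¬ FOLBox (neg C)) :
    ∃ Δ, IsHenkin N Δ ∧ C ∈ Δ := by
  obtain ⟨e, he⟩ := exists_surjective_nat Formula
  set S := henkinStage N e C
  have hmono : ∀ {m n A}, m ≤ n → FOLBox ((S m).imp A) → FOLBox ((S n).imp A) :=
    fun hmn hA => FOLBox.imp_trans (henkinStage_antitone hmn) hA
  have hmp : ∀ {A B : Formula}, (∃ n, FOLBox ((S n).imp (A.imp B))) →
      (∃ n, FOLBox ((S n).imp A)) → ∃ n, FOLBox ((S n).imp B) := by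
    rintro A B ⟨m, hm⟩ ⟨n, hn⟩
    refine ⟨max m n, FOLBox.mp (FOLBox.mp (FOLBox.taut ?_) (hmono (le_max_left m n) hm))
      (hmono (le_max_right m n) hn)⟩
    intro f _ hi
    simp only [hi]
    tauto
  have hcons : ∀ {A : Formula}, (∃ n, FOLBox ((S n).imp (neg A))) →
      ¬ ∃ n, FOLBox ((S n).imp A) := by
    rintro A ⟨m, hm⟩ ⟨n, hn⟩
    refine henkinStage_consistent (N := N) (e := e) h (max m n) (FOLBox.mp (FOLBox.mp
      (FOLBox.taut ?_) (hmono (le_max_left m n) hm)) (hmono (le_max_right m n) hn))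
    intro f hf hi
    simp only [hi, hf]
    tauto
  have hstep : ∀ n, ¬ FOLBox (neg ((S n).and (e n))) →
      S (n + 1) = ((S n).and (e n)).and (witness (N + varBound ((S n).and (e n))) (e n)) :=
    fun n hn => if_neg hn
  have hneg : ∀ n, FOLBox (neg ((S n).and (e n))) → FOLBox ((S n).imp (neg (e n))) := by
    intro n hn
    refine FOLBox.mp (FOLBox.taut ?_) hn
    intro f hf hi
    simp only [Formula.and, hi, hf]
    tauto
  refine ⟨{A | ∃ n, FOLBox ((S n).imp A)}, ⟨?_, hmp, ?_, ?_⟩, 0, ?_⟩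
  · intro A hA
    exact ⟨0, FOLBox.mp (FOLBox.taut fun f _ hi => by simp only [hi]; tauto) hA⟩
  · intro A
    refine ⟨hcons, fun hA => ?_⟩
    obtain ⟨n, rfl⟩ := he A
    by_cases hn : FOLBox (neg ((S n).and (e n)))
    · exact ⟨n, hneg n hn⟩
    · refine absurd ⟨n + 1, ?_⟩ hA
      rw [hstep n hn]
      refine FOLBox.taut fun f hf hi => ?_
      simp only [Formula.and, hi, hf]
      tauto
  · intro x B hB
    obtain ⟨n, hn⟩ := he (neg (all x B))
    by_cases hc : FOLBox (neg ((S n).and (e n)))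
    · have := hneg n hc
      rw [hn] at this
      exact absurd hB (hcons ⟨n, this⟩)
    · refine ⟨varBound ((S n).and (e n)), n + 1, ?_⟩
      rw [hstep n hc, hn]
      refine FOLBox.taut fun f hf hi => ?_
      simp only [witness, Formula.and, hi, hf]
      tauto
  · exact FOLBox.taut fun f _ hi => (hi _ _).mpr id

namespace IsHenkin

variable {N : ℕ} {Δ : Set Formula}

theorem imp_iff (h : IsHenkin N Δ) (A B : Formula) : A.imp B ∈ Δ ↔ (A ∈ Δ → B ∈ Δ) := by
  refine ⟨h.mp, fun hAB => ?_⟩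
  by_cases hA : A ∈ Δ
  · refine h.mp (h.thm (FOLBox.taut fun f _ hi => ?_)) (hAB hA)
    simp only [hi]; tauto
  · refine h.mp (h.thm (FOLBox.taut fun f hf hi => ?_)) ((h.neg_iff A).mpr hA)
    simp only [hi, hf]; tauto

theorem and_iff (h : IsHenkin N Δ) (A B : Formula) : A.and B ∈ Δ ↔ A ∈ Δ ∧ B ∈ Δ := by
  simp only [Formula.and, h.neg_iff, h.imp_iff]
  tauto

theorem eq_refl (h : IsHenkin N Δ) (a : ℕ) : Formula.eq a a ∈ Δ := h.thm FOLBox.axId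

theorem eq_euclid (h : IsHenkin N Δ) {a b c : ℕ} (hab : Formula.eq a b ∈ Δ)
    (hac : Formula.eq a c ∈ Δ) : Formula.eq b c ∈ Δ :=
  h.mp (h.thm (FOLBox.eq_euclid a b c)) ((h.and_iff _ _).mpr ⟨hab, hac⟩)

/-- Provable equality of the variables `N + k`. -/
def setoid (h : IsHenkin N Δ) : Setoid ℕ where
  r k l := Formula.eq (N + k) (N + l) ∈ Δ
  iseqv :=
    ⟨fun _ => h.eq_refl _, fun hab => h.eq_euclid hab (h.eq_refl _),
      fun hab hbc => h.eq_euclid (h.eq_euclid hab (h.eq_refl _)) hbc⟩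

theorem atom_congr (h : IsHenkin N Δ) {j : ℕ} {xs ys : List ℕ}
    (hxy : xs.map (Quotient.mk h.setoid) = ys.map (Quotient.mk h.setoid)) (l : List ℕ)
    (hx : atom j (l ++ xs.map (N + ·)) ∈ Δ) : atom j (l ++ ys.map (N + ·)) ∈ Δ := by
  induction xs generalizing ys l with
  | nil =>
    cases ys with
    | nil => exact hx
    | cons b ys => simp at hxy
  | cons a xs ih =>
    cases ys with
    | nil => simp at hxy
    | cons b ys =>
      simp only [List.map_cons, List.cons.injEq] at hxy hx ⊢
      have hab : Formula.eq (N + a) (N + b) ∈ Δ := Quotient.exact hxy.1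
      have hb := h.mp (h.thm (FOLBox.atom_congr j (N + a) (N + b) l _))
        ((h.and_iff _ _).mpr ⟨hab, hx⟩)
      have := ih hxy.2 (l ++ [N + b]) (by simpa using hb)
      simpa using this

/-- The term model of a Henkin theory, with a single world. -/
def model (h : IsHenkin N Δ) : Structure where
  W := Unit
  wNonempty := ⟨()⟩
  D := fun _ => Quotient h.setoid
  dNonempty := fun _ => ⟨Quotient.mk _ 0⟩
  I := fun j _ ds =>
    ∃ xs : List ℕ, ds = xs.map (Quotient.mk h.setoid) ∧ atom j (xs.map (N + ·)) ∈ Δ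

/-- The valuation of the term model induced by a map of variables. -/
def valuation (h : IsHenkin N Δ) (τ : ℕ → ℕ) : Valuation h.model :=
  fun x _ => Quotient.mk h.setoid (τ x)

theorem updateVal_valuation (h : IsHenkin N Δ) (τ : ℕ → ℕ) (x k : ℕ) :
    updateVal (h.valuation τ) x () (Quotient.mk h.setoid k) =
      h.valuation (Function.update τ x k) := by
  funext y w
  by_cases hy : y = x
  · subst hy
    refine (dif_pos ⟨rfl, rfl⟩).trans ?_
    simp only [valuation, Function.update_self]
    rfl
  · refine (dif_neg fun hyw => hy hyw.1).trans ?_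
    simp only [valuation, Function.update_of_ne hy]
    rfl

theorem update_add (τ : ℕ → ℕ) (x k : ℕ) :
    Function.update (fun z => N + τ z) x (N + k) = fun z => N + Function.update τ x k z := by
  funext z
  by_cases hz : z = x
  · subst hz; simp
  · simp [hz]

theorem all_iff (h : IsHenkin N Δ) {A : Formula} {x : ℕ}
    (hs : ∀ k, Substitutable (N + k) x A) :
    all x A ∈ Δ ↔ ∀ k, A.subst (N + k) x ∈ Δ := by
  refine ⟨fun hA k => h.mp (h.thm (FOLBox.axAll1 (hs k))) hA, fun hA => ?_⟩
  by_contra hc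
  obtain ⟨k, hk⟩ := h.exists_witness ((h.neg_iff _).mpr hc)
  exact (h.neg_iff _).mp hk (hA k)

theorem sat_iff (h : IsHenkin N Δ) {A : Formula} (hA : BoxFree A) (hN : varBound A ≤ N)
    (τ : ℕ → ℕ) :
    Sat h.model (h.valuation τ) () A ↔ msubst (fun z => N + τ z) A ∈ Δ := by
  induction A generalizing τ with
  | atom j l =>
    have hl : (l.map fun z => N + τ z) = (l.map τ).map (N + ·) := by simp
    simp only [Sat, msubst, hl]
    constructor
    · rintro ⟨xs, hxs, hx⟩
      refine h.atom_congr (xs := xs) ?_ [] hx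
      rw [← hxs, List.map_map]; rfl
    · exact fun hl => ⟨l.map τ, by rw [List.map_map]; rfl, hl⟩
  | eq a b => exact Quotient.eq (r := h.setoid)
  | neg A ih => simp only [Sat, msubst, h.neg_iff, ih hA hN]
  | imp A B ihA ihB =>
    simp only [varBound] at hN
    simp only [Sat, msubst, h.imp_iff, ihA hA.1 (by omega), ihB hA.2 (by omega)]
  | all x A ih =>
    simp only [varBound] at hN
    have hsub : ∀ k, (msubst (Function.update (fun z => N + τ z) x x) A).subst (N + k) x =
        msubst (fun z => N + Function.update τ x k z) A := by
      intro k
      rw [subst_msubst (fun v _ => by omega), update_add]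
    simp only [msubst]
    rw [h.all_iff fun k => substitutable_msubst (by omega)]
    simp only [hsub, ← ih hA (by omega), ← h.updateVal_valuation]
    exact ⟨fun hs k => hs _, fun hs a => Quotient.inductionOn a hs⟩
  | box A => exact hA.elim

end IsHenkin

/-- Completeness: every classical first-order thesis is derivable. -/
theorem folBox_of_mem_FOL {A : Formula} (hA : A ∈ FOL) : FOLBox A := by
  refine FOLBox.mp (FOLBox.closure_imp (varBound A) A) ?_
  set B := closure (varBound A) A
  by_contra hB
  have hcons : ¬ FOLBox (neg (neg B)) := fun hn =>
    hB (FOLBox.mp (FOLBox.taut fun f hf hi => by simp only [hi, hf]; tauto) hn)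
  obtain ⟨Δ, h, hΔ⟩ := exists_isHenkin (varBound B) hcons
  refine (h.neg_iff B).mp hΔ ?_
  have hsat := (h.sat_iff (hA.1.closure _) le_rfl id).mp ((hA.2 h.model).closure _ _ _)
  rwa [msubst_of_fixes_free fun v hv => ?_] at hsat
  obtain ⟨hle, hfree⟩ := le_of_freeIn_closure hv
  exact absurd hfree (not_freeIn_of_varBound_le hle)

theorem box_mem_iff_mem_FOL {Γ : Set Formula} (hΓ : MaxConsistent Γ) {A : Formula}
    (hA : BoxFree A) : box A ∈ Γ ↔ A ∈ FOL := by
  constructor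
  · intro hbox
    by_contra hn
    exact hΓ.1 [box A] (by simp) (by simpa using hbox) (FOLBox.axBang hA hn)
  · intro hmem
    refine (hΓ.2 (box A)).resolve_right fun hneg => ?_
    refine hΓ.1 [neg (box A)] (by simp) (by simpa using hneg) ?_
    refine FOLBox.mp (FOLBox.taut fun f hf hi => ?_) (FOLBox.nec (folBox_of_mem_FOL hmem))
    simp only [conjList, hi, hf]
    tauto

/-- for Γ, Δ ∈ MC and □-free A, □A ∈ Γ iff □A ∈ Δ. -/
theorem box_boxfree_agree (Γ Δ : Set Formula) (hΓ : Γ ∈ MC) (hΔ : Δ ∈ MC)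
    (A : Formula) (hA : Formula.BoxFree A) :
    Formula.box A ∈ Γ ↔ Formula.box A ∈ Δ := by
  rw [box_mem_iff_mem_FOL hΓ.2 hA, box_mem_iff_mem_FOL hΔ.2 hA]

end FOLBoxPaper
end

section
/- For every formula A and every variable x, the formulas ∃x□A ↔ ∀x□A, ∀x□A ↔ □A, and hence ∃x□A ↔ □A are provable in FOL□. -/
namespace FOLBoxPaper

open Formula

namespace FOLBox

/-- Vacuous quantifiers may be introduced. -/
theorem imp_all_of_not_freeIn {A : Formula} {x : ℕ} (h : ¬ FreeIn x A) :
    FOLBox (A.imp (all x A)) :=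
  mp (axAll2 h) (gen x (taut fun _ _ hi => (hi A A).2 id))

theorem iff_intro {A B : Formula} (h₁ : FOLBox (A.imp B)) (h₂ : FOLBox (B.imp A)) :
    FOLBox (A.iff B) := by
  refine mp (mp (taut fun _ hn hi => ?_) h₁) h₂
  simp only [Formula.iff, Formula.and, hn, hi]
  tauto

theorem iff_symm {A B : Formula} (h : FOLBox (A.iff B)) : FOLBox (B.iff A) := by
  refine mp (taut fun _ hn hi => ?_) h
  simp only [Formula.iff, Formula.and, hn, hi]
  tauto

theorem iff_trans {A B C : Formula} (h₁ : FOLBox (A.iff B)) (h₂ : FOLBox (B.iff C)) :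
    FOLBox (A.iff C) := by
  refine mp (mp (taut fun _ hn hi => ?_) h₁) h₂
  simp only [Formula.iff, Formula.and, hn, hi]
  tauto

theorem all_box_iff (A : Formula) (x : ℕ) : FOLBox ((all x (box A)).iff (box A)) :=
  iff_intro (axAll1 (A := box A) (y := x) trivial) (imp_all_of_not_freeIn id)

theorem all_neg_box_iff (A : Formula) (x : ℕ) :
    FOLBox ((all x (neg (box A))).iff (neg (box A))) :=
  iff_intro (axAll1 (A := neg (box A)) (y := x) trivial) (imp_all_of_not_freeIn id)

theorem ex_box_iff (A : Formula) (x : ℕ) : FOLBox ((ex x (box A)).iff (box A)) := by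
  refine mp (taut fun _ hn hi => ?_) (all_neg_box_iff A x)
  simp only [Formula.iff, Formula.and, ex, hn, hi]
  tauto

end FOLBox

/-- ∃x□A ↔ ∀x□A, ∀x□A ↔ □A, and ∃x□A ↔ □A are provable
in FOL□. -/
theorem quantified_box (A : Formula) (x : ℕ) :
    FOLBox ((Formula.ex x (Formula.box A)).iff (Formula.all x (Formula.box A))) ∧
    FOLBox ((Formula.all x (Formula.box A)).iff (Formula.box A)) ∧
    FOLBox ((Formula.ex x (Formula.box A)).iff (Formula.box A)) :=
  ⟨FOLBox.iff_trans (FOLBox.ex_box_iff A x) (FOLBox.iff_symm (FOLBox.all_box_iff A x)),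
    FOLBox.all_box_iff A x, FOLBox.ex_box_iff A x⟩

end FOLBoxPaper
end
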